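/- (Generating-function identity and centrality, affine case.) Fix 1 ≤ i ≤ k−1 and suppose that for each ℓ ∈ ℤ there is an element Z_{i−1}^{(ℓ)} in the subalgebra of W_k generated by T_1,…,T_{i−2}, E_1,…,E_{i−2}, Y_1^{±1},…,Y_{i−1}^{±1} such that E_i Y_i^ℓ E_i = Z_{i−1}^{(ℓ)} E_i. Then: (a) for every ℓ ∈ ℤ, the element E_i Y_i^ℓ E_i of W_k commutes with T_j and E_j for 1 ≤ j ≤ i−2 and with Y_j for 1 ≤ j ≤ i−1; and (b) setting Z_{i−1}⁺ = Σ_{ℓ≥0} Z_{i−1}^{(ℓ)} u^{−ℓ} and Z_{i−1}⁻ = Σ_{ℓ≥0} Z_{i−1}^{(−ℓ)} u^{−ℓ}, the identity ( Z_{i−1}⁻ − z/(q−q⁻¹) − u²/(u²−1) )( Z_{i−1}⁺ + z⁻¹/(q−q⁻¹) − u²/(u²−1) ) E_i = ( −(u²−q²)(u²−q⁻²) / ( (u²−1)²(q−q⁻¹)² ) ) E_i holds in the ring of formal Laurent series in u⁻¹ over W_k, where u²/(u²−1) := Σ_{m≥0} u^{−2m} and 1/(u²−1) := Σ_{m≥1}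 u^{−2m}. -/

import Mathlib

/-- A `C`-algebra `A` together with elements satisfying the defining relations of the
affine BMW algebra `W_k` with parameters `q, z ∈ Cˣ` and `Z₀⁽ℓ⁾ ∈ C` (`ℓ ∈ ℤ`).
Indexing is 0-based: the paper's `T_i, E_i` (for `1 ≤ i ≤ k-1`) are `T (i-1) _, E (i-1) _`
here, and the paper's `Y_i` (for `1 ≤ i ≤ k`) is `Y (i-1)`.  The fields `Y_zero`, `Y_succ`
say `Y₁ = z X^{ε₁}`, `Y_{i+1} = T_i Y_i T_i`, and `E_def` is the equation
`T_i Y_i = Y_{i+1} T_i - (q - q⁻¹) Y_{i+1} (1 - E_i)` defining `E_i`. -/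
structure AffBMW (C : Type*) [CommRing C] (k : ℕ) (q z : Cˣ) (Z₀ : ℤ → C)
    (A : Type*) [Ring A] [Algebra C A] where
  T : ∀ i : ℕ, i + 1 < k → A
  Tinv : ∀ i : ℕ, i + 1 < k → A
  X : A
  E : ∀ i : ℕ, i + 1 < k → A
  Y : ℕ → A
  Yinv : ℕ → A
  T_Tinv : ∀ i (h : i + 1 < k), T i h * Tinv i h = 1
  Tinv_T : ∀ i (h : i + 1 < k), Tinv i h * T i h = 1
  braid_far : ∀ i j (hi : i + 1 < k) (hj : j + 1 < k), i + 2 ≤ j →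
      T i hi * T j hj = T j hj * T i hi
  braid : ∀ i (h : i + 2 < k),
      T i (by omega) * T (i + 1) h * T i (by omega) =
        T (i + 1) h * T i (by omega) * T (i + 1) h
  XTXT : ∀ h : 1 < k, X * T 0 h * X * T 0 h = T 0 h * X * T 0 h * X
  X_T : ∀ i (h : i + 1 < k), 1 ≤ i → X * T i h = T i h * X
  Y_zero : Y 0 = (z : C) • X
  Y_succ : ∀ i (h : i + 1 < k), Y (i + 1) = T i h * Y i * T i h
  Y_Yinv : ∀ i, i < k → Y i * Yinv i = 1
  Yinv_Y : ∀ i, i < k → Yinv i * Y i = 1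
  E_def : ∀ i (h : i + 1 < k),
      T i h * Y i =
        Y (i + 1) * T i h -
          ((q : C) - ((q⁻¹ : Cˣ) : C)) • (Y (i + 1) * (1 - E i h))
  E_T : ∀ i (h : i + 1 < k), E i h * T i h = ((z⁻¹ : Cˣ) : C) • E i h
  T_E : ∀ i (h : i + 1 < k), T i h * E i h = ((z⁻¹ : Cˣ) : C) • E i h
  E_Tinv : ∀ i (h : i + 1 < k), E i h * Tinv i h = (z : C) • E i h
  Tinv_E : ∀ i (h : i + 1 < k), Tinv i h * E i h = (z : C) • E i h
  ETE_up : ∀ i (h : i + 1 < k) (h' : i + 2 < k),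
      E i h * T (i + 1) h' * E i h = (z : C) • E i h
  ETinvE_up : ∀ i (h : i + 1 < k) (h' : i + 2 < k),
      E i h * Tinv (i + 1) h' * E i h = ((z⁻¹ : Cˣ) : C) • E i h
  ETE_down : ∀ i (h : i + 1 < k) (h' : i - 1 + 1 < k), 1 ≤ i →
      E i h * T (i - 1) h' * E i h = (z : C) • E i h
  ETinvE_down : ∀ i (h : i + 1 < k) (h' : i - 1 + 1 < k), 1 ≤ i →
      E i h * Tinv (i - 1) h' * E i h = ((z⁻¹ : Cˣ) : C) • E i h
  EYE : ∀ (h : 1 < k) (ℓ : ℤ),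
      E 0 h * (if 0 ≤ ℓ then Y 0 ^ ℓ.toNat else Yinv 0 ^ (-ℓ).toNat) * E 0 h =
        Z₀ ℓ • E 0 h
  E_YY : ∀ i (h : i + 1 < k), E i h * (Y i * Y (i + 1)) = E i h
  YY_E : ∀ i (h : i + 1 < k), (Y i * Y (i + 1)) * E i h = E i h

noncomputable section

/-- `a/(u - a) := Σ_{ℓ≥1} a^ℓ u^{-ℓ}`, a formal Laurent series in `u⁻¹`
(an element of `LaurentSeries A = HahnSeries ℤ A` whose variable is `u⁻¹`). -/
def geomU {A : Type*} [Ring A] (a : A) : LaurentSeries A :=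
  HahnSeries.ofPowerSeries ℤ A (PowerSeries.mk fun n => if n = 0 then 0 else a ^ n)

/-- `1/(u - a) := Σ_{ℓ≥1} a^{ℓ-1} u^{-ℓ}`. -/
def invU {A : Type*} [Ring A] (a : A) : LaurentSeries A :=
  HahnSeries.ofPowerSeries ℤ A (PowerSeries.mk fun n => if n = 0 then 0 else a ^ (n - 1))

/-- `a/(u² - a) := Σ_{ℓ≥1} a^ℓ u^{-2ℓ}`. -/
def geomU2 {A : Type*} [Ring A] (a : A) : LaurentSeries A :=
  HahnSeries.ofPowerSeries ℤ A
    (PowerSeries.mk fun n => if n = 0 then 0 else if n % 2 = 0 then a ^ (n / 2) else 0)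

/-- `1/(u² - a) := Σ_{ℓ≥1} a^{ℓ-1} u^{-2ℓ}`. -/
def invU2 {A : Type*} [Ring A] (a : A) : LaurentSeries A :=
  HahnSeries.ofPowerSeries ℤ A
    (PowerSeries.mk fun n => if n = 0 then 0 else if n % 2 = 0 then a ^ (n / 2 - 1) else 0)

/-- `u²/(u² - 1) := Σ_{m≥0} u^{-2m}`. -/
def selfU2 (A : Type*) [Ring A] : LaurentSeries A :=
  HahnSeries.ofPowerSeries ℤ A (PowerSeries.mk fun n => if n % 2 = 0 then 1 else 0)

/-- `1/(u² - 1) := Σ_{m≥1} u^{-2m}`. -/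
def invU2one (A : Type*) [Ring A] : LaurentSeries A :=
  HahnSeries.ofPowerSeries ℤ A
    (PowerSeries.mk fun n => if n = 0 then 0 else if n % 2 = 0 then 1 else 0)

/-- The variable `u` itself (the inverse of the Laurent series variable `u⁻¹`). -/
def Uvar (A : Type*) [Ring A] : LaurentSeries A := HahnSeries.single (-1 : ℤ) 1

/-- A constant Laurent series. -/
def cst {A : Type*} [Ring A] (a : A) : LaurentSeries A := HahnSeries.C a

end

/-- With `v = u⁻¹`, `s = u² / (u² - 1)`, `P = u / (u - y)` and `M = u / (u - y⁻¹)`, this is the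
partial fraction identity `M P = s (P + M - 1)`. -/
theorem geom_mul_geom_inv {R : Type*} [Ring R] {v s y yi P M : R}
    (hv : ∀ x, Commute v x) (hs : ∀ x, Commute s x) (hsv : s * (1 - v * v) = 1)
    (hyyi : y * yi = 1) (hyiy : yi * y = 1)
    (hP : (1 - v * y) * P = 1) (hP' : P * (1 - v * y) = 1)
    (hM : (1 - v * yi) * M = 1) (hM' : M * (1 - v * yi) = 1) :
    M * P = s * (P + M - 1) := by
  have key : ∀ a b : R, a * b = 1 → (1 - v * a) * (1 - v * b) = 1 - v * a - v * b + v * v := by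
    intro a b hab
    have h1 : v * a * (v * b) = v * v := by
      rw [mul_assoc, ← mul_assoc a, ← (hv a).eq, mul_assoc v a b, hab, mul_one]
    rw [sub_mul, mul_sub, mul_sub, h1]
    noncomm_ring
  have hD : (1 - v * y) * (1 - v * yi) = (1 - v * yi) * (1 - v * y) := by
    rw [key _ _ hyyi, key _ _ hyiy]; noncomm_ring
  have hcomm : P * M = M * P := by
    refine (left_inv_eq_right_inv (a := (1 - v * y) * (1 - v * yi)) ?_ ?_).symm
    · rw [mul_assoc, ← mul_assoc P, hP', one_mul, hM']
    · rw [hD, mul_assoc, ← mul_assoc (1 - v * y), hP, one_mul, hM]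
  have h1 : M * P * (1 - v * y) = M := by rw [mul_assoc, hP', mul_one]
  have h2 : M * P * (1 - v * yi) = P := by rw [← hcomm, mul_assoc, hM', mul_one]
  have h3 : M * P * (1 - v * yi - v * y + v * v) = 1 := by
    rw [← key _ _ hyiy, ← mul_assoc, h2, hP']
  have h4 : P + M - 1 = M * P * (1 - v * v) := by
    linear_combination (norm := noncomm_ring) -h1 - h2 + h3
  rw [h4, ← mul_assoc, (hs _).eq, mul_assoc, hsv, mul_one]

/-- If `t y = y' t - κ y' (1 - e)` and `e` absorbs `y'` into `yi = y⁻¹`, then the eigenvalue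
series `Zp, Zm` of the geometric series `P, M` of `y, yi` satisfy a quadratic relation on `e`.
Here `v` plays the role of `u⁻¹` and `s` that of `u² / (u² - 1)`. -/
theorem quadratic_relation_of_intertwining {C R : Type*} [CommRing C] [Ring R] [Algebra C R]
    {κ κi z zi : C} (hκ : κ * κi = 1) (hzi : z * zi = 1)
    {v s t e y y' P M P' Zp Zm : R}
    (hv : ∀ x, Commute v x) (hs : ∀ x, Commute s x)
    (hMP : M * P = s * (P + M - 1))
    (hP : (1 - v * y) * P = 1) (hP' : P' * (1 - v * y') = 1)
    (ht : t * y = y' * t - κ • (y' * (1 - e)))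
    (het : e * t = zi • e) (hte : t * e = zi • e)
    (hee : e * e = (1 + (z - zi) * κi) • e)
    (heP' : e * P' = e * M)
    (hZp : e * P * e = Zp * e) (hZm : e * M * e = Zm * e) :
    (Zm - (z * κi) • (1 : R) - s) * (Zp + (zi * κi) • (1 : R) - s) * e =
      (s * s - s - (κi * κi) • (1 : R)) * e := by
  have hP'' : P' * (v * y') = P' - 1 := by
    rw [mul_sub, mul_one] at hP'; rw [← hP']; abel
  have h0 : (1 - v * y') * t = t * (1 - v * y) - κ • (v * y' * (1 - e)) := by
    have : t * (v * y) = v * (t * y) := by rw [← mul_assoc, ← (hv t).eq, mul_assoc]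
    rw [mul_sub, this, ht, mul_sub, mul_smul_comm]
    noncomm_ring
  have h1 : t * P = P' * t - κ • ((P' - 1) * (1 - e) * P) := by
    have := congrArg (fun x => P' * x * P) h0
    have hl : P' * ((1 - v * y') * t) * P = t * P := by rw [← mul_assoc, hP', one_mul]
    have hr : P' * (t * (1 - v * y)) * P = P' * t := by
      rw [mul_assoc, mul_assoc, hP, mul_one]
    have hr' : P' * (v * y' * (1 - e)) * P = (P' - 1) * (1 - e) * P := by
      rw [← mul_assoc, hP'']
    rwa [hl, mul_sub, sub_mul, hr, mul_smul_comm, smul_mul_assoc, hr'] at this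
  have h2 : zi • (Zp * e) =
      zi • (Zm * e) - κ • (e * (M - 1) * (1 - e) * P * e) := by
    have hl : e * (t * P) * e = zi • (Zp * e) := by
      rw [← mul_assoc, het, smul_mul_assoc, smul_mul_assoc, hZp]
    have hr : e * (P' * t) * e = zi • (Zm * e) := by
      rw [mul_assoc, mul_assoc, hte, mul_smul_comm, mul_smul_comm, ← mul_assoc, heP', hZm]
    have hr' : e * ((P' - 1) * (1 - e) * P) * e = e * (M - 1) * (1 - e) * P * e := by
      have : e * (P' - 1) = e * (M - 1) := by rw [mul_sub, heP', mul_sub]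
      rw [← this]; simp only [mul_assoc]
    rw [← hl, h1, mul_sub, sub_mul, hr, mul_smul_comm, smul_mul_assoc, hr']
  have h3 : e * (M - 1) * (1 - e) * P * e =
      s * (Zp * e) + s * (Zm * e) - (1 + (z - zi) * κi) • (s * e) - Zp * e - Zm * (Zp * e)
        + (1 + (z - zi) * κi) • (Zp * e) := by
    have hPe : e * (P * e) = Zp * e := by rw [← mul_assoc, hZp]
    have hMe : e * (M * e) = Zm * e := by rw [← mul_assoc, hZm]
    have hMPe : e * (M * (P * e)) = s * (Zp * e) + s * (Zm * e) -
        (1 + (z - zi) * κi) • (s * e) := by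
      rw [← mul_assoc M, hMP, ← mul_assoc, ← mul_assoc, ← (hs e).eq, mul_assoc, mul_assoc,
        sub_mul, add_mul, one_mul, mul_sub, mul_add, hPe, hMe, hee, mul_sub, mul_add,
        mul_smul_comm]
    have hMeP : e * (M * (e * (P * e))) = Zm * (Zp * e) := by
      rw [← mul_assoc M, ← mul_assoc e, hMe, mul_assoc, hPe]
    have heeP : e * (e * (P * e)) = (1 + (z - zi) * κi) • (Zp * e) := by
      rw [← mul_assoc, hee, smul_mul_assoc, hPe]
    simp only [mul_sub, sub_mul, mul_one, mul_assoc, hMPe, hMeP, heeP]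
    rw [hPe]
    abel
  rw [h3] at h2
  have h4 : (Zm - (z * κi) • (1 : R) - s) * (Zp + (zi * κi) • (1 : R) - s) * e =
      Zm * (Zp * e) + (zi * κi) • (Zm * e) - s * (Zm * e) - (z * κi) • (Zp * e)
       - (z * κi * (zi * κi)) • e + (z * κi) • (s * e) - s * (Zp * e) - (zi * κi) • (s * e)
       + s * (s * e) := by
    have : Zm * s = s * Zm := (hs Zm).eq.symm
    simp only [mul_sub, sub_mul, mul_add, add_mul, smul_mul_assoc, mul_smul_comm, one_mul, mul_one,
      smul_sub, this, mul_assoc, smul_smul]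
    module
  rw [h4]
  have h5 : (s * s - s - (κi * κi) • (1 : R)) * e = s * (s * e) - s * e - (κi * κi) • e := by
    simp only [sub_mul, smul_mul_assoc, one_mul, mul_assoc]
  rw [h5]
  have h6 := congrArg (fun x => κi • x) h2
  have hscal : κi * κi = z * κi * (zi * κi) := by linear_combination (-κi * κi) * hzi
  simp only [smul_sub κi (zi • _), smul_smul κi κ, mul_comm κi κ, hκ, one_smul] at h6
  rw [hscal]
  linear_combination (norm := module) -h6

namespace PowerSeries

variable {A : Type*} [Ring A]

theorem commute_of_forall_coeff {f : PowerSeries A} (hf : ∀ n x, Commute (coeff n f) x)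
    (g : PowerSeries A) : Commute f g := by
  ext n
  rw [coeff_mul, coeff_mul, ← Finset.Nat.sum_antidiagonal_swap]
  exact Finset.sum_congr rfl fun p _ => hf _ _

theorem one_sub_X_mul_C_mul_mk_pow (a : A) :
    (1 - X * C a) * (mk fun n => a ^ n) = 1 := by
  ext n
  cases n with
  | zero => simp [sub_mul, mul_assoc]
  | succ n => simp [sub_mul, mul_assoc, coeff_succ_X_mul, pow_succ', coeff_one]

theorem mk_pow_mul_one_sub_X_mul_C (a : A) :
    (mk fun n => a ^ n) * (1 - X * C a) = 1 := by
  ext n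
  cases n with
  | zero => simp [mul_sub, X_mul, ← mul_assoc]
  | succ n => simp [mul_sub, X_mul, ← mul_assoc, coeff_succ_mul_X, pow_succ, coeff_one]

theorem mk_even_mul_one_sub_X_sq :
    (mk fun n => if n % 2 = 0 then (1 : A) else 0) * (1 - X * X) = 1 := by
  ext n
  rw [mul_sub, mul_one, ← mul_assoc]
  match n with
  | 0 => simp
  | 1 => simp [coeff_one, coeff_succ_mul_X 0]
  | n + 2 => simp [coeff_one, coeff_succ_mul_X]

end PowerSeries

namespace AffBMW

variable {C : Type*} [CommRing C] {k : ℕ} {q z : Cˣ} {Z₀ : ℤ → C}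
  {A : Type*} [Ring A] [Algebra C A] (B : AffBMW C k q z Z₀ A)


theorem T_comm_Y_of_lt {i j : ℕ} (hj : j + 1 < k) (hij : i < j) :
    Commute (B.T j hj) (B.Y i) := by
  induction i with
  | zero =>
    rw [B.Y_zero]
    exact Commute.smul_right (B.X_T j hj hij).symm _
  | succ i ih =>
    have hT : Commute (B.T j hj) (B.T i (by omega)) :=
      (B.braid_far i j (by omega) hj (by omega)).symm
    rw [B.Y_succ i (by omega)]
    exact (hT.mul_right (ih (by omega))).mul_right hT

theorem T_comm_Y_of_gt {i j : ℕ} (hj : j + 1 < k) (hi : i < k) (hij : j + 2 ≤ i) :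
    Commute (B.T j hj) (B.Y i) := by
  induction i, hij using Nat.le_induction with
  | base =>
    have hY := (B.T_comm_Y_of_lt (i := j) (j := j + 1) hi (by omega)).eq
    have hb := B.braid j hi
    rw [B.Y_succ (j + 1) hi, B.Y_succ j hj]
    set t := B.T j hj
    set s := B.T (j + 1) hi
    set y := B.Y j
    show t * (s * (t * y * t) * s) = s * (t * y * t) * s * t
    calc t * (s * (t * y * t) * s) = t * s * t * y * t * s := by noncomm_ring
      _ = s * t * (s * y) * t * s := by rw [hb]; noncomm_ring
      _ = s * t * y * (s * t * s) := by rw [hY]; noncomm_ring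
      _ = s * (t * y * t) * s * t := by rw [← hb]; noncomm_ring
  | succ i hi' ih =>
    have hT : Commute (B.T j hj) (B.T i (by omega)) :=
      B.braid_far j i hj (by omega) (by omega)
    rw [B.Y_succ i (by omega)]
    exact (hT.mul_right (ih (by omega))).mul_right hT

theorem Y_comm_of_lt {i j : ℕ} (hj : j < k) (hij : i < j) : Commute (B.Y i) (B.Y j) := by
  induction j generalizing i with
  | zero => omega
  | succ j ih =>
    have far : ∀ i, i < j → Commute (B.Y i) (B.Y (j + 1)) := by
      intro i hi
      rw [B.Y_succ j hj]
      have hT := (B.T_comm_Y_of_lt hj hi).symm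
      exact (hT.mul_right (ih (by omega) hi)).mul_right hT
    obtain hi | rfl := Nat.lt_succ_iff_lt_or_eq.mp hij
    · exact far i hi
    · cases i with
      | zero =>
        rw [B.Y_succ 0 hj, B.Y_zero]
        have hX : Commute B.X (B.T 0 hj * B.X * B.T 0 hj) := by
          have := B.XTXT hj
          simpa only [Commute, SemiconjBy, mul_assoc] using this
        simpa only [mul_smul_comm, smul_mul_assoc] using
          (hX.smul_left (z : C)).smul_right (z : C)
      | succ i =>
        have hT : Commute (B.T i (by omega)) (B.Y (i + 1 + 1)) :=
          B.T_comm_Y_of_gt _ hj le_rfl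
        have hY := far i (by omega)
        rw [show B.Y (i + 1) = _ from B.Y_succ i (by omega)]
        exact (hT.mul_left hY).mul_left hT

theorem Y_comm {i j : ℕ} (hi : i < k) (hj : j < k) : Commute (B.Y i) (B.Y j) := by
  rcases lt_trichotomy i j with hij | rfl | hij
  · exact B.Y_comm_of_lt hj hij
  · exact Commute.refl _
  · exact (B.Y_comm_of_lt hi hij).symm

theorem comm_Yinv {a : A} {i : ℕ} (hi : i < k) (ha : Commute a (B.Y i)) :
    Commute a (B.Yinv i) :=
  Commute.units_inv_right (u := ⟨B.Y i, B.Yinv i, B.Y_Yinv i hi, B.Yinv_Y i hi⟩) ha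

theorem smul_one_sub_E {i : ℕ} (h : i + 1 < k) :
    ((q : C) - ((q⁻¹ : Cˣ) : C)) • (1 - B.E i h) =
      B.T i h - B.Yinv (i + 1) * B.T i h * B.Y i := by
  rw [mul_assoc, B.E_def i h, mul_sub, ← mul_assoc, mul_smul_comm, ← mul_assoc,
    B.Yinv_Y _ h]
  simp

theorem comm_E [Invertible ((q : C) - ((q⁻¹ : Cˣ) : C))] {a : A} {i : ℕ} (h : i + 1 < k)
    (hT : Commute a (B.T i h)) (hY : Commute a (B.Y i)) (hY' : Commute a (B.Y (i + 1))) :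
    Commute a (B.E i h) := by
  have hE : B.E i h = 1 - ⅟((q : C) - ((q⁻¹ : Cˣ) : C)) •
      (B.T i h - B.Yinv (i + 1) * B.T i h * B.Y i) := by
    rw [← B.smul_one_sub_E h, smul_smul, invOf_mul_self, one_smul, sub_sub_cancel]
  rw [hE]
  exact (Commute.one_right a).sub_right
    ((hT.sub_right (((B.comm_Yinv h hY').mul_right hT).mul_right hY)).smul_right _)

theorem comm_Y_ite_pow {a : A} {i : ℕ} (hi : i < k) (ha : Commute a (B.Y i)) (ℓ : ℤ) :
    Commute a (if 0 ≤ ℓ then B.Y i ^ ℓ.toNat else B.Yinv i ^ (-ℓ).toNat) := by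
  split_ifs
  · exact ha.pow_right _
  · exact (B.comm_Yinv hi ha).pow_right _

theorem E_mul_E [Invertible ((q : C) - ((q⁻¹ : Cˣ) : C))] {i : ℕ} (h : i + 1 < k) :
    B.E i h * B.E i h = (1 + ((z : C) - ((z⁻¹ : Cˣ) : C)) * ⅟((q : C) - ((q⁻¹ : Cˣ) : C))) •
      B.E i h := by
  have hE : ((q : C) - ((q⁻¹ : Cˣ) : C)) • (1 - B.E i h) = B.T i h - B.Tinv i h := by
    rw [B.smul_one_sub_E h]
    congr 1
    have h1 : B.Y (i + 1) * B.Tinv i h = B.T i h * B.Y i := by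
      rw [B.Y_succ i h, mul_assoc, B.T_Tinv, mul_one]
    rw [mul_assoc, ← h1, ← mul_assoc, B.Yinv_Y _ h, one_mul]
  have h2 := congrArg (fun x => ⅟((q : C) - ((q⁻¹ : Cˣ) : C)) • (x * B.E i h)) hE
  simp only [smul_mul_assoc, smul_smul, invOf_mul_self, one_smul, sub_mul, one_mul, B.T_E,
    B.Tinv_E] at h2
  linear_combination (norm := module) -h2

theorem E_mul_Y_succ {i : ℕ} (h : i + 1 < k) :
    B.E i h * B.Y (i + 1) = B.E i h * B.Yinv i := by
  have hc := (B.Y_comm (i := i) (j := i + 1) (by omega) h).eq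
  conv_rhs => rw [← B.E_YY i h, hc, mul_assoc, mul_assoc, B.Y_Yinv i (by omega), mul_one]

theorem E_mul_Y_succ_pow {i : ℕ} (h : i + 1 < k) (n : ℕ) :
    B.E i h * B.Y (i + 1) ^ n = B.E i h * B.Yinv i ^ n := by
  induction n with
  | zero => simp
  | succ n ih =>
    have hc : Commute (B.Y (i + 1)) (B.Yinv i) :=
      B.comm_Yinv (by omega) (B.Y_comm h (by omega))
    rw [pow_succ, ← mul_assoc, ih, mul_assoc, ← (hc.pow_right n).eq, ← mul_assoc,
      B.E_mul_Y_succ h, mul_assoc, ← pow_succ']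

/-- The quadratic relation between the generating functions `Z⁺` and `Z⁻` of the elements
`E_i Y_i^ℓ E_i`, as an identity of power series in `u⁻¹`. -/
theorem generating_function_powerSeries [Invertible ((q : C) - ((q⁻¹ : Cˣ) : C))]
    {i : ℕ} (h : i + 1 < k) {Zp Zm : ℕ → A}
    (hp : ∀ n, B.E i h * B.Y i ^ n * B.E i h = Zp n * B.E i h)
    (hm : ∀ n, B.E i h * B.Yinv i ^ n * B.E i h = Zm n * B.E i h) :
    (PowerSeries.mk Zm - ((z : C) * ⅟((q : C) - ((q⁻¹ : Cˣ) : C))) • (1 : PowerSeries A) -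
          PowerSeries.mk fun n => if n % 2 = 0 then 1 else 0) *
        (PowerSeries.mk Zp +
          (((z⁻¹ : Cˣ) : C) * ⅟((q : C) - ((q⁻¹ : Cˣ) : C))) • (1 : PowerSeries A) -
          PowerSeries.mk fun n => if n % 2 = 0 then 1 else 0) * PowerSeries.C (B.E i h) =
      ((PowerSeries.mk fun n => if n % 2 = 0 then 1 else 0) *
          (PowerSeries.mk fun n => if n % 2 = 0 then 1 else 0) -
          (PowerSeries.mk fun n => if n % 2 = 0 then 1 else 0) -
        (⅟((q : C) - ((q⁻¹ : Cˣ) : C)) * ⅟((q : C) - ((q⁻¹ : Cˣ) : C))) •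
          (1 : PowerSeries A)) * PowerSeries.C (B.E i h) := by
  have hsmul : ∀ (c : C) (a : A), PowerSeries.C (c • a) = c • PowerSeries.C a := by
    intro c a
    ext n
    simp [PowerSeries.coeff_C, apply_ite (c • ·)]
  have hv : ∀ f : PowerSeries A, Commute PowerSeries.X f := fun f =>
    (PowerSeries.commute_X f).symm
  have hs : ∀ f : PowerSeries A, Commute (PowerSeries.mk fun n => if n % 2 = 0 then 1 else 0) f :=
    PowerSeries.commute_of_forall_coeff fun n x => by
      rw [PowerSeries.coeff_mk]
      split_ifs
      · exact Commute.one_left x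
      · exact Commute.zero_left x
  have hMP := geom_mul_geom_inv hv hs PowerSeries.mk_even_mul_one_sub_X_sq
    (y := PowerSeries.C (B.Y i)) (yi := PowerSeries.C (B.Yinv i))
    (by rw [← map_mul, B.Y_Yinv i (by omega), map_one])
    (by rw [← map_mul, B.Yinv_Y i (by omega), map_one])
    (PowerSeries.one_sub_X_mul_C_mul_mk_pow _) (PowerSeries.mk_pow_mul_one_sub_X_mul_C _)
    (PowerSeries.one_sub_X_mul_C_mul_mk_pow _) (PowerSeries.mk_pow_mul_one_sub_X_mul_C _)
  refine quadratic_relation_of_intertwining (mul_invOf_self ((q : C) - ((q⁻¹ : Cˣ) : C)))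
    z.mul_inv hv hs hMP
    (PowerSeries.one_sub_X_mul_C_mul_mk_pow _)
    (PowerSeries.mk_pow_mul_one_sub_X_mul_C (B.Y (i + 1)))
    (t := PowerSeries.C (B.T i h)) ?_ ?_ ?_ ?_ ?_ ?_ ?_
  · rw [← map_mul, B.E_def i h, map_sub, map_mul, hsmul, map_mul, map_sub, map_one]
  · rw [← map_mul, B.E_T, hsmul]
  · rw [← map_mul, B.T_E, hsmul]
  · rw [← map_mul, B.E_mul_E, hsmul]
  · ext n
    simp [B.E_mul_Y_succ_pow h]
  · ext n
    simp [hp]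
  · ext n
    simp [hm]

end AffBMW

theorem HahnSeries.ofPowerSeries_smul_one {C A : Type*} [CommRing C] [Ring A] [Algebra C A]
    (c : C) : HahnSeries.ofPowerSeries ℤ A (c • 1) = c • (1 : LaurentSeries A) :=
  map_smul (HahnSeries.ofPowerSeriesAlg ℤ C (A := A)) c 1 |>.trans (by rw [map_one])

theorem invU2one_eq (A : Type*) [Ring A] : invU2one A = selfU2 A - 1 := by
  rw [invU2one, selfU2, ← map_one (HahnSeries.ofPowerSeries ℤ A), ← map_sub]
  congr 1
  ext n
  rcases n with _ | n <;> simp [PowerSeries.coeff_one]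

theorem Uvar_sq_mul_invU2one (A : Type*) [Ring A] : Uvar A ^ 2 * invU2one A = selfU2 A := by
  have h1 : invU2one A = HahnSeries.single (1 : ℤ) 1 ^ 2 * selfU2 A := by
    rw [invU2one, selfU2, ← HahnSeries.ofPowerSeries_X, ← map_pow, ← map_mul]
    congr 1
    ext n
    rw [PowerSeries.X_pow_mul]
    match n with
    | 0 => simp [PowerSeries.coeff_mul_X_pow']
    | 1 => simp [PowerSeries.coeff_mul_X_pow']
    | n + 2 => simp [PowerSeries.coeff_mul_X_pow']
  rw [h1, Uvar, ← mul_assoc]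
  simp [HahnSeries.single_pow]

/-- `(u² - q²)(u² - q⁻²) / (u² - 1)² = 1 - (q - q⁻¹)² u² / (u² - 1)²`, where
`u² / (u² - 1)²` is written as `s² - s` for `s = u² / (u² - 1)`. -/
theorem factor_mul_invU2one_sq {C A : Type*} [CommRing C] [Ring A] [Algebra C A] {q qi : C}
    (hq : q * qi = 1) :
    (Uvar A ^ 2 - q ^ 2 • (1 : LaurentSeries A)) * (Uvar A ^ 2 - qi ^ 2 • (1 : LaurentSeries A)) *
        (invU2one A * invU2one A) =
      1 - ((q - qi) * (q - qi)) • (selfU2 A * selfU2 A - selfU2 A) := by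
  have h1 := Uvar_sq_mul_invU2one A
  have h2 : selfU2 A = invU2one A + 1 := by rw [invU2one_eq]; abel
  rw [h2] at h1 ⊢
  generalize invU2one A = w at *
  generalize Uvar A ^ 2 = x at *
  have h3 : x * (w * w) = w * w + w := by rw [← mul_assoc, h1, add_mul, one_mul]
  have h4 : x * (x * (w * w)) = w * w + w + (w + 1) := by rw [h3, mul_add, h3, h1]
  have h5 : (x - q ^ 2 • (1 : LaurentSeries A)) * (x - qi ^ 2 • 1) * (w * w) =
      x * (x * (w * w)) - (q ^ 2 + qi ^ 2) • (x * (w * w)) + (q * qi) ^ 2 • (w * w) := by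
    simp only [mul_sub, sub_mul, smul_mul_assoc, mul_smul_comm, one_mul, mul_one, mul_assoc]
    module
  have h6 : (q - qi) * (q - qi) = q ^ 2 + qi ^ 2 - 2 := by linear_combination (-2) * hq
  rw [h5, h4, h3, hq, h6]
  simp only [mul_add, add_mul, mul_one, one_mul]
  module

/-- generating-function identity and centrality, affine case; Theorem 3.5,
(3.33) of the paper.  All indices are 0-indexed: the paper's `E_i`, `Z_{i-1}` (for a
fixed `1 ≤ i ≤ k-1`) correspond to `E i₀ _`, `Zc` with `i₀ = i - 1`; the paper's
generators `T_1,…,T_{i-2}, E_1,…,E_{i-2}` are the `T j _, E j _` with `j + 2 ≤ i₀` and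
`Y_1^{±1},…,Y_{i-1}^{±1}` are the `Y j, Yinv j` with `j < i₀`. -/
theorem affine_BMW_generating_function
    (C : Type*) [CommRing C] (k : ℕ) (q z : Cˣ) (Z₀ : ℤ → C)
    (A : Type*) [Ring A] [Algebra C A]
    [Invertible ((q : C) - ((q⁻¹ : Cˣ) : C))]
    (hk : 2 ≤ k)
    (B : AffBMW C k q z Z₀ A)
    (i₀ : ℕ) (h : i₀ + 1 < k)
    (Zc : ℤ → A)
    (hmem : ∀ ℓ : ℤ, Zc ℓ ∈ Algebra.adjoin C
      ({x : A | ∃ j, ∃ hj : j + 1 < k, j + 2 ≤ i₀ ∧ (x = B.T j hj ∨ x = B.E j hj)} ∪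
        {x : A | ∃ j, j < i₀ ∧ (x = B.Y j ∨ x = B.Yinv j)}))
    (hz : ∀ ℓ : ℤ,
      B.E i₀ h * (if 0 ≤ ℓ then B.Y i₀ ^ ℓ.toNat else B.Yinv i₀ ^ (-ℓ).toNat) * B.E i₀ h =
        Zc ℓ * B.E i₀ h) :
    -- (a) centrality of the elements `E_i Y_i^ℓ E_i` in `W_{i-1}`
    ((∀ (ℓ : ℤ) j (hj : j + 1 < k), j + 2 ≤ i₀ →
        Commute (B.E i₀ h * (if 0 ≤ ℓ then B.Y i₀ ^ ℓ.toNat else B.Yinv i₀ ^ (-ℓ).toNat) *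
            B.E i₀ h) (B.T j hj) ∧
        Commute (B.E i₀ h * (if 0 ≤ ℓ then B.Y i₀ ^ ℓ.toNat else B.Yinv i₀ ^ (-ℓ).toNat) *
            B.E i₀ h) (B.E j hj)) ∧
      (∀ (ℓ : ℤ) j, j < i₀ →
        Commute (B.E i₀ h * (if 0 ≤ ℓ then B.Y i₀ ^ ℓ.toNat else B.Yinv i₀ ^ (-ℓ).toNat) *
            B.E i₀ h) (B.Y j))) ∧
    -- (b) `(Z⁻ - z/(q-q⁻¹) - u²/(u²-1))(Z⁺ + z⁻¹/(q-q⁻¹) - u²/(u²-1)) Eᵢ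
    --        = -(u²-q²)(u²-q⁻²)/((u²-1)²(q-q⁻¹)²) Eᵢ`
    (HahnSeries.ofPowerSeries ℤ A (PowerSeries.mk fun n => Zc (-(n : ℤ))) -
          ((z : C) * ⅟((q : C) - ((q⁻¹ : Cˣ) : C))) • (1 : LaurentSeries A) -
          selfU2 A) *
        (HahnSeries.ofPowerSeries ℤ A (PowerSeries.mk fun n => Zc (n : ℤ)) +
          (((z⁻¹ : Cˣ) : C) * ⅟((q : C) - ((q⁻¹ : Cˣ) : C))) • (1 : LaurentSeries A) -
          selfU2 A) * cst (B.E i₀ h) =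
      -(⅟((q : C) - ((q⁻¹ : Cˣ) : C)) • ⅟((q : C) - ((q⁻¹ : Cˣ) : C)) •
          ((Uvar A ^ 2 - (q : C) ^ 2 • (1 : LaurentSeries A)) *
            (Uvar A ^ 2 - ((q⁻¹ : Cˣ) : C) ^ 2 • (1 : LaurentSeries A)) *
            (invU2one A * invU2one A))) * cst (B.E i₀ h) := by
  have hi : i₀ < k := by omega
  have central : ∀ (a : A) (ℓ : ℤ), Commute a (B.T i₀ h) → Commute a (B.Y i₀) →
      Commute a (B.Y (i₀ + 1)) →
      Commute (B.E i₀ h * (if 0 ≤ ℓ then B.Y i₀ ^ ℓ.toNat else B.Yinv i₀ ^ (-ℓ).toNat) *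
        B.E i₀ h) a := fun a ℓ hT hY hY' =>
    have hE := B.comm_E h hT hY hY'
    ((hE.mul_right (B.comm_Y_ite_pow hi hY ℓ)).mul_right hE).symm
  refine ⟨⟨fun ℓ j hj hji => ?_, fun ℓ j hj => ?_⟩, ?_⟩
  · have hTT : Commute (B.T j hj) (B.T i₀ h) := B.braid_far j i₀ hj h hji
    have hTY := B.T_comm_Y_of_gt hj hi hji
    have hTY' := B.T_comm_Y_of_gt hj h (by omega)
    have hET := B.comm_E hj hTT.symm (B.T_comm_Y_of_lt h (by omega))
      (B.T_comm_Y_of_lt h (by omega))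
    have hEY := B.comm_E hj hTY.symm (B.Y_comm hi (by omega)) (B.Y_comm hi (by omega))
    have hEY' := B.comm_E hj hTY'.symm (B.Y_comm h (by omega)) (B.Y_comm h (by omega))
    exact ⟨central _ ℓ hTT hTY hTY', central _ ℓ hET.symm hEY.symm hEY'.symm⟩
  · exact central _ ℓ (B.T_comm_Y_of_lt h hj).symm (B.Y_comm (by omega) hi)
      (B.Y_comm (by omega) h)
  · have hp : ∀ n : ℕ, B.E i₀ h * B.Y i₀ ^ n * B.E i₀ h = Zc (n : ℤ) * B.E i₀ h := fun n => by
      simpa using hz n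
    have hm : ∀ n : ℕ, B.E i₀ h * B.Yinv i₀ ^ n * B.E i₀ h = Zc (-(n : ℤ)) * B.E i₀ h := by
      rintro (_ | n)
      · simpa using hz 0
      · have hneg : ¬ (0 : ℤ) ≤ -((n + 1 : ℕ) : ℤ) := by omega
        simpa only [if_neg hneg, neg_neg, Int.toNat_natCast] using hz (-((n + 1 : ℕ) : ℤ))
    have key := congrArg (HahnSeries.ofPowerSeries ℤ A)
      (B.generating_function_powerSeries h hp hm)
    simp only [map_mul, map_sub, map_add, HahnSeries.ofPowerSeries_smul_one,
      HahnSeries.ofPowerSeries_C] at key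
    refine key.trans ?_
    rw [factor_mul_invU2one_sq q.mul_inv, smul_sub, smul_sub, smul_smul, smul_smul, smul_smul]
    have hone : ⅟((q : C) - ((q⁻¹ : Cˣ) : C)) * ⅟((q : C) - ((q⁻¹ : Cˣ) : C)) *
        (((q : C) - ((q⁻¹ : Cˣ) : C)) * ((q : C) - ((q⁻¹ : Cˣ) : C))) = 1 := by
      rw [mul_assoc, invOf_mul_cancel_left, invOf_mul_self]
    rw [hone, one_smul, neg_sub]
    rfl
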